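/- Suppose R is the adjacency matrix of the complete graph on d vertices, i.e. R_{ii} = 0 for all i and R_{ij} = 1 for all i ≠ j. Then with probability one, V(n) → (1/d, 1/d, …, 1/d) as n → ∞. -/

import Mathlib

open MeasureTheory Filter Finset

namespace VRRW

noncomputable def simplex (d : ℕ) : Set (Fin d → ℝ) :=
  {v | (∀ i, 0 ≤ v i) ∧ ∑ i, v i = 1}

noncomputable def Nvec {d : ℕ} (R : Matrix (Fin d) (Fin d) ℝ) (v : Fin d → ℝ) (i : Fin d) : ℝ :=
  ∑ j, R i j * v j

noncomputable def Hfun {d : ℕ} (R : Matrix (Fin d) (Fin d) ℝ) (v : Fin d → ℝ) : ℝ :=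
  ∑ i, ∑ j, R i j * v i * v j

noncomputable def piVec {d : ℕ} (R : Matrix (Fin d) (Fin d) ℝ) (v : Fin d → ℝ) : Fin d → ℝ :=
  fun i => v i * Nvec R v i / Hfun R v

noncomputable def Mmat {d : ℕ} (R : Matrix (Fin d) (Fin d) ℝ) (v : Fin d → ℝ) :
    Matrix (Fin d) (Fin d) ℝ :=
  fun i j => R i j * v j / Nvec R v i

noncomputable def critSet {d : ℕ} (R : Matrix (Fin d) (Fin d) ℝ) : Set (Fin d → ℝ) :=
  {v | v ∈ simplex d ∧ 0 < Hfun R v ∧ piVec R v = v}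

noncomputable def degenSet {d : ℕ} (R : Matrix (Fin d) (Fin d) ℝ) : Set (Fin d → ℝ) :=
  {v | v ∈ simplex d ∧ ((∃ i, Nvec R v i = 0) ∨ ∃ i j, ∀ k, 1 ≤ k → (Mmat R v ^ k) i j = 0)}

/-- `S_i(n)`: one plus the number of visits to state `i` strictly after time `d`, up to time `n`. -/
noncomputable def visits {d : ℕ} {Ω : Type*} (Y : ℕ → Ω → Fin d) (n : ℕ) (ω : Ω) (i : Fin d) : ℝ :=
  1 + (((Finset.Ioc d n).filter fun m => Y m ω = i).card : ℝ)

/-- `V(n) = S(n)/n`, the fractional occupation vector. -/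
noncomputable def occup {d : ℕ} {Ω : Type*} (Y : ℕ → Ω → Fin d) (n : ℕ) (ω : Ω) : Fin d → ℝ :=
  fun i => visits Y n ω i / n

/-- The natural filtration `F_n = σ(Y_d, …, Y_n)`. -/
def natFilt {d : ℕ} {Ω : Type*} (Y : ℕ → Ω → Fin d) (n : ℕ) : MeasurableSpace Ω :=
  ⨆ m ∈ Finset.Icc d n, MeasurableSpace.comap (Y m) ⊤

/-- The defining properties of the vertex-reinforced random walk driven by `R`:
measurability, start `Y_d = 1` (state `1` is encoded as index `0` of `Fin d`), and the
reinforced transition probabilities, expressed via conditional expectation of indicators. -/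
def IsVRRW {d : ℕ} {Ω : Type*} [MeasurableSpace Ω] (μ : Measure Ω)
    (R : Matrix (Fin d) (Fin d) ℝ) (Y : ℕ → Ω → Fin d) : Prop :=
  (∀ n, Measurable (Y n)) ∧
  (∀ ω, (Y d ω : ℕ) = 0) ∧
  (∀ n, d ≤ n → ∀ j : Fin d,
    (μ[(fun ω => if Y (n + 1) ω = j then (1 : ℝ) else 0) | natFilt Y n])
      =ᵐ[μ] fun ω => R (Y n ω) j * visits Y n ω j / ∑ i, R (Y n ω) i * visits Y n ω i)

/-- Euclidean distance from a point to a set: `inf {|x − y| : y ∈ A}`. -/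
noncomputable def distToSet {d : ℕ} (x : Fin d → ℝ) (A : Set (Fin d → ℝ)) : ℝ :=
  sInf ((fun y => Real.sqrt (∑ i, (x i - y i) ^ 2)) '' A)

end VRRW

open VRRW MeasureTheory Filter

namespace VRRW

section Path

variable {d : ℕ} {Ω : Type*} (Y : ℕ → Ω → Fin d)

/-- The sum of the squares of the coordinates of the occupation vector. -/
noncomputable def sqNorm (n : ℕ) (ω : Ω) : ℝ := ∑ i, occup Y n ω i ^ 2

/-- The total visit count of the states other than the current one. -/
noncomputable def otherVisits (n : ℕ) (ω : Ω) : ℝ := n - visits Y n ω (Y n ω)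

theorem visits_succ {n : ℕ} (hn : d ≤ n) (ω : Ω) (i : Fin d) :
    visits Y (n + 1) ω i = visits Y n ω i + if Y (n + 1) ω = i then 1 else 0 := by
  unfold visits
  rw [← Finset.insert_Ioc_right_eq_Ioc_add_one (by omega), Finset.filter_insert]
  split_ifs
  · rw [Finset.card_insert_of_notMem (by simp)]
    push_cast
    ring
  · simp

theorem one_le_visits (n : ℕ) (ω : Ω) (i : Fin d) : 1 ≤ visits Y n ω i := by
  simp [visits]

theorem sum_visits {n : ℕ} (hn : d ≤ n) (ω : Ω) : ∑ i, visits Y n ω i = n := by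
  induction n, hn using Nat.le_induction with
  | base => simp [visits]
  | succ n hn ih => simp [visits_succ Y hn, Finset.sum_add_distrib, ih]

theorem visits_add_le {n : ℕ} (hn : d ≤ n) (ω : Ω) (j : Fin d) :
    visits Y n ω j + (d - 1) ≤ n := by
  have h := Finset.sum_le_sum fun i (_ : i ∈ Finset.univ.erase j) => one_le_visits Y n ω i
  have h2 := Finset.add_sum_erase Finset.univ (visits Y n ω) (Finset.mem_univ j)
  rw [sum_visits Y hn] at h2
  have hd : 1 ≤ d := j.pos
  rw [Finset.sum_const, Finset.card_erase_of_mem (Finset.mem_univ j), Finset.card_univ,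
    Fintype.card_fin, nsmul_eq_mul, Nat.cast_sub hd, Nat.cast_one, mul_one] at h
  linarith

theorem sub_one_le_otherVisits {n : ℕ} (hn : d ≤ n) (ω : Ω) :
    (d : ℝ) - 1 ≤ otherVisits Y n ω := by
  have := visits_add_le Y hn ω (Y n ω)
  unfold otherVisits
  linarith

theorem sum_occup (hd : 2 ≤ d) {n : ℕ} (hn : d ≤ n) (ω : Ω) : ∑ i, occup Y n ω i = 1 := by
  have : (n : ℝ) ≠ 0 := by norm_cast; omega
  simp [occup, ← Finset.sum_div, sum_visits Y hn, this]

theorem sum_sq_sub (hd : 2 ≤ d) {n : ℕ} (hn : d ≤ n) (ω : Ω) :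
    ∑ i, (occup Y n ω i - 1 / d) ^ 2 = sqNorm Y n ω - 1 / d := by
  have : (d : ℝ) ≠ 0 := by norm_cast; omega
  simp only [sub_sq, Finset.sum_add_distrib, Finset.sum_sub_distrib, ← Finset.sum_mul,
    ← Finset.mul_sum, sum_occup Y hd hn, sqNorm]
  simp
  field_simp
  ring

theorem sqNorm_sub_inv_nonneg (hd : 2 ≤ d) {n : ℕ} (hn : d ≤ n) (ω : Ω) :
    0 ≤ sqNorm Y n ω - 1 / d := by
  rw [← sum_sq_sub Y hd hn]
  positivity

theorem sqNorm_le_one (hd : 2 ≤ d) {n : ℕ} (hn : d ≤ n) (ω : Ω) : sqNorm Y n ω ≤ 1 := by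
  have h0 : ∀ i, 0 ≤ occup Y n ω i := fun i =>
    div_nonneg (by linarith [one_le_visits Y n ω i]) (by positivity)
  rw [← sum_occup Y hd hn ω]
  refine Finset.sum_le_sum fun i _ => ?_
  have : occup Y n ω i ≤ 1 := by
    rw [← sum_occup Y hd hn ω]
    exact Finset.single_le_sum (fun j _ => h0 j) (Finset.mem_univ i)
  nlinarith [h0 i]

theorem sqNorm_succ (hd : 2 ≤ d) {n : ℕ} (hn : d ≤ n) (ω : Ω) :
    visits Y (n + 1) ω (Y (n + 1) ω) / ((n : ℝ) + 1) ^ 2 =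
      (sqNorm Y (n + 1) ω - sqNorm Y n ω) / 2 + sqNorm Y n ω / (n + 1) +
        (1 - sqNorm Y n ω) / (2 * ((n : ℝ) + 1) ^ 2) := by
  have hn0 : (n : ℝ) ≠ 0 := by norm_cast; omega
  have hn1 : (n : ℝ) + 1 ≠ 0 := by positivity
  have h1 : ∀ m : ℕ, sqNorm Y m ω = (∑ i, visits Y m ω i ^ 2) / (m : ℝ) ^ 2 := fun m => by
    simp [sqNorm, occup, div_pow, Finset.sum_div]
  have h2 : ∑ i, visits Y (n + 1) ω i ^ 2 =
      ∑ i, visits Y n ω i ^ 2 + 2 * visits Y n ω (Y (n + 1) ω) + 1 := by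
    simp [visits_succ Y hn, add_sq, Finset.sum_add_distrib]
  rw [h1, h1, h2, visits_succ Y hn]
  simp
  field_simp
  ring

theorem abs_sqNorm_succ_sub_le (hd : 2 ≤ d) {n : ℕ} (hn : d ≤ n) (ω : Ω) :
    |sqNorm Y (n + 1) ω - sqNorm Y n ω| ≤ 4 / ((n : ℝ) + 1) := by
  have hp : (0 : ℝ) < (n : ℝ) + 1 := by positivity
  have h := sqNorm_succ Y hd hn ω
  have hq1 := sqNorm_le_one Y hd hn ω
  have hq0 : 0 ≤ sqNorm Y n ω := Finset.sum_nonneg fun i _ => sq_nonneg _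
  have hv := visits_add_le Y (Nat.le_succ_of_le hn) ω (Y (n + 1) ω)
  have hv1 := one_le_visits Y (n + 1) ω (Y (n + 1) ω)
  have hd' : (2 : ℝ) ≤ d := by exact_mod_cast hd
  push_cast at hv
  have e1 : visits Y (n + 1) ω (Y (n + 1) ω) / ((n : ℝ) + 1) ^ 2 ≤ 1 / ((n : ℝ) + 1) := by
    rw [div_le_div_iff₀ (by positivity) hp]
    nlinarith
  have e2 : 0 ≤ visits Y (n + 1) ω (Y (n + 1) ω) / ((n : ℝ) + 1) ^ 2 := by positivity
  have e3 : sqNorm Y n ω / (n + 1) ≤ 1 / ((n : ℝ) + 1) := by gcongr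
  have e4 : 0 ≤ sqNorm Y n ω / ((n : ℝ) + 1) := by positivity
  have e5 : (1 - sqNorm Y n ω) / (2 * ((n : ℝ) + 1) ^ 2) ≤ 1 / ((n : ℝ) + 1) := by
    rw [div_le_div_iff₀ (by positivity) hp]
    nlinarith [mul_nonneg hq0 hp.le]
  have e6 : 0 ≤ (1 - sqNorm Y n ω) / (2 * ((n : ℝ) + 1) ^ 2) :=
    div_nonneg (by linarith) (by positivity)
  have e7 : 4 / ((n : ℝ) + 1) = 4 * (1 / ((n : ℝ) + 1)) := by ring
  rw [abs_le, e7]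
  constructor <;> linarith

/-- The tangent line inequality for `x ↦ 1 / x` at `x = (d - 1) / d`, summed along the path. -/
theorem le_inv_otherVisits_succ (hd : 2 ≤ d) {n : ℕ} (hn : d ≤ n) (ω : Ω) {c : ℝ}
    (hc : c = d / (d - 1)) :
    c / ((n : ℝ) + 1) + c ^ 2 * ((sqNorm Y n ω - 1 / d) / (n + 1)) +
      c ^ 2 * ((sqNorm Y (n + 1) ω - sqNorm Y n ω) / 2) ≤ 1 / otherVisits Y (n + 1) ω := by
  have hp : (0 : ℝ) < (n : ℝ) + 1 := by positivity
  have hd' : (2 : ℝ) ≤ d := by exact_mod_cast hd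
  have hd1 : (d : ℝ) - 1 ≠ 0 := by linarith
  have h := sqNorm_succ Y hd hn ω
  have e6 : 0 ≤ (1 - sqNorm Y n ω) / (2 * ((n : ℝ) + 1) ^ 2) :=
    div_nonneg (by linarith [sqNorm_le_one Y hd hn ω]) (by positivity)
  have hO := sub_one_le_otherVisits Y (Nat.le_succ_of_le hn) ω
  have hOdef : otherVisits Y (n + 1) ω = (n : ℝ) + 1 - visits Y (n + 1) ω (Y (n + 1) ω) := by
    simp [otherVisits]
  generalize otherVisits Y (n + 1) ω = O at *
  have hO0 : 0 < O := by linarith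
  generalize visits Y (n + 1) ω (Y (n + 1) ω) = s at *
  obtain rfl : s = n + 1 - O := by linarith
  have key : 2 * c / ((n : ℝ) + 1) - c ^ 2 * O / ((n : ℝ) + 1) ^ 2 ≤ 1 / O := by
    have : 1 / O - (2 * c / ((n : ℝ) + 1) - c ^ 2 * O / ((n : ℝ) + 1) ^ 2) =
        (((n : ℝ) + 1) - c * O) ^ 2 / (O * ((n : ℝ) + 1) ^ 2) := by
      field_simp
      ring
    have h2 : 0 ≤ (((n : ℝ) + 1) - c * O) ^ 2 / (O * ((n : ℝ) + 1) ^ 2) := by positivity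
    linarith
  have h3 : c ^ 2 * (((n : ℝ) + 1 - O) / ((n : ℝ) + 1) ^ 2) =
      c ^ 2 / ((n : ℝ) + 1) - c ^ 2 * O / ((n : ℝ) + 1) ^ 2 := by
    field_simp
  have h4 : c ^ 2 * (1 - 1 / d) = c := by
    have : (d : ℝ) ≠ 0 := by linarith
    rw [hc]
    field_simp
  have h5 : c / ((n : ℝ) + 1) = c ^ 2 / (n + 1) - c ^ 2 * ((1 / d) / (n + 1)) := by
    nth_rewrite 1 [← h4]
    ring
  have h6 : 2 * c / ((n : ℝ) + 1) = 2 * (c / ((n : ℝ) + 1)) := by ring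
  have h7 := mul_nonneg (sq_nonneg c) e6
  rw [h] at h3
  rw [sub_div]
  linarith

theorem sum_inv_visits (N : ℕ) (ω : Ω) :
    ∑ k ∈ Finset.range N, 1 / visits Y (d + k) ω (Y (d + k + 1) ω) ≤
      d * ∑ k ∈ Finset.range N, 1 / ((k : ℝ) + 1) := by
  set cnt : ℕ → Fin d → ℕ := fun n i => ((Finset.Ioc d n).filter fun m => Y m ω = i).card
  have h : ∑ k ∈ Finset.range N, 1 / visits Y (d + k) ω (Y (d + k + 1) ω) =
      ∑ i, ∑ k ∈ Finset.range (cnt (d + N) i), 1 / ((k : ℝ) + 1) := by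
    induction N with
    | zero => simp [cnt]
    | succ N ih =>
      have hs : ∀ i, cnt (d + (N + 1)) i =
          cnt (d + N) i + if Y (d + N + 1) ω = i then 1 else 0 := fun i => by
        have := visits_succ Y (Nat.le_add_right d N) ω i
        have h2 : ((cnt (d + (N + 1)) i : ℕ) : ℝ) =
            ((cnt (d + N) i + if Y (d + N + 1) ω = i then 1 else 0 : ℕ) : ℝ) := by
          push_cast
          simp only [visits] at this
          rw [← add_assoc]
          linarith
        exact_mod_cast h2
      have hi : ∀ i, ∑ k ∈ Finset.range (cnt (d + (N + 1)) i), 1 / ((k : ℝ) + 1) =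
          ∑ k ∈ Finset.range (cnt (d + N) i), 1 / ((k : ℝ) + 1) +
            if Y (d + N + 1) ω = i then 1 / visits Y (d + N) ω i else 0 := fun i => by
        rw [hs]
        split_ifs
        · rw [Finset.sum_range_succ, visits, add_comm (1 : ℝ)]
        · simp
      simp only [hi]
      rw [Finset.sum_range_succ, ih, Finset.sum_add_distrib]
      simp
  rw [h]
  calc _ ≤ ∑ _i : Fin d, ∑ k ∈ Finset.range N, 1 / ((k : ℝ) + 1) := by
        refine Finset.sum_le_sum fun i _ => ?_
        refine Finset.sum_le_sum_of_subset_of_nonneg (Finset.range_mono ?_)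
          fun _ _ _ => by positivity
        exact (Finset.card_filter_le _ _).trans (by simp)
    _ = _ := by simp

/-- The compensated sum of inverse visit counts is bounded above, up to a multiple of the
accumulated distance of the occupation vector from uniformity. -/
theorem sum_compensated_le (hd : 2 ≤ d) (N : ℕ) (ω : Ω) :
    ∑ k ∈ Finset.range (N + 1), (1 / visits Y (d + k) ω (Y (d + k + 1) ω) -
        (d - 1) / otherVisits Y (d + k) ω) ≤
      2 * (d : ℝ) ^ 2 - ∑ k ∈ Finset.range N, (sqNorm Y (d + k) ω - 1 / d) / ((d + k : ℕ) + 1) := by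
  have hd' : (2 : ℝ) ≤ d := by exact_mod_cast hd
  obtain ⟨c, hc⟩ : ∃ c : ℝ, c = d / (d - 1) := ⟨_, rfl⟩
  have hcd : (d - 1) * c = d := by
    have : (d : ℝ) - 1 ≠ 0 := by linarith
    rw [hc]
    field_simp
  have hc1 : 1 ≤ c := by nlinarith
  have hc2 : c ≤ 2 := by nlinarith
  set G := ∑ k ∈ Finset.range N, (sqNorm Y (d + k) ω - 1 / d) / (((d + k : ℕ) : ℝ) + 1) with hG
  have hG0 : 0 ≤ G := Finset.sum_nonneg fun k _ =>
    div_nonneg (sqNorm_sub_inv_nonneg Y hd (Nat.le_add_right d k) ω) (by positivity)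
  set T := ∑ k ∈ Finset.range N, 1 / (((d + k : ℕ) : ℝ) + 1) with hT
  have hA : c * T + c ^ 2 * G - c ^ 2 / 2 ≤
      ∑ k ∈ Finset.range (N + 1), 1 / otherVisits Y (d + k) ω := by
    rw [Finset.sum_range_succ']
    have h0 : 0 ≤ 1 / otherVisits Y (d + 0) ω := by
      have := sub_one_le_otherVisits Y (Nat.le_add_right d 0) ω
      exact div_nonneg zero_le_one (by linarith)
    have h1 := Finset.sum_le_sum fun k (_ : k ∈ Finset.range N) =>
      le_inv_otherVisits_succ Y hd (Nat.le_add_right d k) ω hc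
    have h2 := Finset.sum_range_sub (fun k => sqNorm Y (d + k) ω) N
    simp only [← add_assoc] at h2
    simp only [Finset.sum_add_distrib, ← Finset.mul_sum, ← Finset.sum_div, h2] at h1
    have h3 := sqNorm_le_one Y hd (Nat.le_add_right d 0) ω
    have h4 : 0 ≤ sqNorm Y (d + N) ω := Finset.sum_nonneg fun i _ => sq_nonneg _
    have h5 : ∑ k ∈ Finset.range N, c / (((d + k : ℕ) : ℝ) + 1) = c * T := by
      rw [hT, Finset.mul_sum]
      simp [div_eq_mul_inv]
    simp only [← add_assoc]
    rw [h5, ← hG] at h1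
    have : c ^ 2 * ((sqNorm Y (d + N) ω - sqNorm Y (d + 0) ω) / 2) ≥ c ^ 2 * (-1 / 2) := by
      gcongr
      linarith
    linarith
  have hX := sum_inv_visits Y (N + 1) ω
  have hH : ∑ k ∈ Finset.range (N + 1), 1 / ((k : ℝ) + 1) ≤ d + T := by
    calc _ ≤ ∑ k ∈ Finset.range (d + N), 1 / ((k : ℝ) + 1) :=
          Finset.sum_le_sum_of_subset_of_nonneg (Finset.range_mono (by omega))
            fun _ _ _ => by positivity
      _ = ∑ k ∈ Finset.range d, 1 / ((k : ℝ) + 1) + T := Finset.sum_range_add _ _ _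
      _ ≤ ∑ _k ∈ Finset.range d, (1 : ℝ) + T := by
          gcongr with k _
          rw [div_le_one (by positivity)]
          linarith [(Nat.cast_nonneg k : (0 : ℝ) ≤ k)]
      _ = _ := by simp
  have hA' := mul_le_mul_of_nonneg_left hA (show (0 : ℝ) ≤ d - 1 by linarith)
  have hX' := hX.trans (mul_le_mul_of_nonneg_left hH (show (0 : ℝ) ≤ d by linarith))
  have e : (d - 1) * (c * T + c ^ 2 * G - c ^ 2 / 2) = d * T + d * c * G - d * c / 2 := by
    linear_combination (T + c * G - c / 2) * hcd
  rw [Finset.sum_sub_distrib, Finset.sum_congr rfl fun k _ =>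
    div_eq_mul_one_div ((d : ℝ) - 1) (otherVisits Y (d + k) ω), ← Finset.mul_sum]
  have : 1 ≤ d * c := by nlinarith
  nlinarith [mul_nonneg (sub_nonneg.2 this) hG0]

end Path

/-- A nonnegative sequence that is summable against `1 / (n + 1)` and whose increments are
`O(1 / n)` tends to zero. -/
theorem tendsto_zero_of_summable_div {g : ℕ → ℝ} {a C : ℝ} (ha : 0 < a) (hg : ∀ n, 0 ≤ g n)
    (hs : Summable fun n => g n / (n + a)) (hinc : ∀ n, |g (n + 1) - g n| ≤ C / (n + a)) :
    Tendsto g atTop (nhds 0) := by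
  have hpos : ∀ n : ℕ, 0 < (n : ℝ) + a := fun n => by positivity
  have hC : 0 ≤ C := by
    have := (abs_nonneg _).trans (hinc 0)
    by_contra! h
    exact absurd this (not_le.2 (div_neg_of_neg_of_pos h (hpos 0)))
  have hsq : Summable fun n : ℕ => 1 / ((n : ℝ) + a) ^ 2 := by
    have h := (Real.summable_one_div_nat_add_rpow a 2).2 (by norm_num)
    simpa using h
  have hdist : Summable fun n => dist (g n ^ 2) (g (n + 1) ^ 2) := by
    refine Summable.of_nonneg_of_le (fun _ => dist_nonneg) (fun n => ?_)
      ((hs.mul_left (2 * C)).add (hsq.mul_left (C ^ 2)))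
    have h1 := hinc n
    have h2 : g (n + 1) + g n ≤ 2 * g n + C / (n + a) := by linarith [(abs_le.1 h1).2]
    have h3 : 0 ≤ C / ((n : ℝ) + a) := div_nonneg hC (hpos n).le
    rw [dist_comm, Real.dist_eq, sq_sub_sq, abs_mul, abs_of_nonneg (add_nonneg (hg _) (hg _))]
    calc _ ≤ (2 * g n + C / (n + a)) * (C / (n + a)) := by
          gcongr
          linarith [hg n]
      _ = _ := by
          have := (hpos n).ne'
          field_simp
  obtain ⟨l, hl⟩ := cauchySeq_tendsto_of_complete (cauchySeq_of_summable_dist hdist)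
  have hg' : Tendsto g atTop (nhds (√l)) := by
    simpa [Real.sqrt_sq, hg] using hl.sqrt
  rcases (Real.sqrt_nonneg l).eq_or_lt with h0 | h0
  · rwa [h0]
  · exfalso
    have hev : ∀ᶠ n : ℕ in atTop, √l / 2 ≤ g n :=
      hg'.eventually_const_le (half_lt_self h0)
    have h1 : Summable fun n : ℕ => 1 / ((n : ℝ) + a) := by
      refine (hs.mul_left (2 / √l)).of_norm_bounded_eventually_nat ?_
      filter_upwards [hev] with n hn
      rw [Real.norm_of_nonneg (one_div_nonneg.2 (hpos n).le), ← mul_div_assoc]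
      have := hpos n
      gcongr
      rw [div_mul_eq_mul_div, le_div_iff₀ h0]
      linarith
    have h2 := (Real.summable_one_div_nat_add_rpow a 1).1 (by
      refine h1.congr fun n => ?_
      rw [abs_of_pos (hpos n), Real.rpow_one])
    exact lt_irrefl _ h2

section Expectation

variable {d : ℕ} {Ω : Type*} {Y : ℕ → Ω → Fin d}

theorem measurable_visits {m : MeasurableSpace Ω} {n : ℕ}
    (hY : ∀ k ∈ Finset.Icc d n, Measurable[m] (Y k)) (i : Fin d) :
    Measurable[m] fun ω => visits Y n ω i := by
  unfold visits
  simp only [Finset.card_filter, Nat.cast_sum]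
  refine measurable_const.add (Finset.measurable_sum _ fun k hk => ?_)
  have hk' : k ∈ Finset.Icc d n := by
    rw [Finset.mem_Ioc] at hk
    exact Finset.mem_Icc.2 ⟨hk.1.le, hk.2⟩
  exact (measurable_of_finite fun j : Fin d => (((if j = i then 1 else 0 : ℕ)) : ℝ)).comp
    (hY k hk')

theorem measurable_natFilt {n k : ℕ} (hk : k ∈ Finset.Icc d n) : Measurable[natFilt Y n] (Y k) := by
  rw [measurable_iff_comap_le]
  exact le_iSup₂ (f := fun k (_ : k ∈ Finset.Icc d n) => MeasurableSpace.comap (Y k) ⊤) k hk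

theorem measurable_apply_index {m : MeasurableSpace Ω} {f : Ω → Fin d → ℝ} {X : Ω → Fin d}
    (hf : ∀ i, Measurable[m] fun ω => f ω i) (hX : Measurable[m] X) :
    Measurable[m] fun ω => f ω (X ω) := by
  have : (fun ω => f ω (X ω)) = fun ω => ∑ i, f ω i * if X ω = i then 1 else 0 := by
    ext ω
    simp
  rw [this]
  exact Finset.measurable_sum _ fun i _ => (hf i).mul
    ((measurable_of_finite fun j : Fin d => if j = i then (1 : ℝ) else 0).comp hX)

variable [MeasurableSpace Ω] {μ : Measure Ω}

theorem natFilt_le (hY : ∀ n, Measurable (Y n)) (n : ℕ) : natFilt Y n ≤ ‹MeasurableSpace Ω› :=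
  iSup₂_le fun k _ => (hY k).comap_le

theorem measurable_otherVisits (hY : ∀ n, Measurable (Y n)) (n : ℕ) :
    Measurable (otherVisits Y n) :=
  measurable_const.sub
    (measurable_apply_index (fun i => measurable_visits (fun k _ => hY k) i) (hY n))

theorem measurable_sqNorm (hY : ∀ n, Measurable (Y n)) (n : ℕ) : Measurable (sqNorm Y n) :=
  Finset.measurable_sum _ fun i _ =>
    ((measurable_visits (fun k _ => hY k) i).div_const _).pow_const 2

theorem ae_summable_of_integral_sum_le {F : ℕ → Ω → ℝ} {K : ℝ} (hF : ∀ n ω, 0 ≤ F n ω)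
    (hi : ∀ n, Integrable (F n) μ) (hK : ∀ N, ∫ ω, ∑ n ∈ Finset.range N, F n ω ∂μ ≤ K) :
    ∀ᵐ ω ∂μ, Summable fun n => F n ω := by
  have hmeas : ∀ n, AEMeasurable (fun ω => ENNReal.ofReal (F n ω)) μ := fun n =>
    (hi n).aemeasurable.ennreal_ofReal
  have hfin : ∫⁻ ω, ∑' n, ENNReal.ofReal (F n ω) ∂μ ≠ ⊤ := by
    rw [lintegral_tsum hmeas]
    refine ne_top_of_le_ne_top (ENNReal.ofReal_ne_top (r := K)) ?_
    rw [ENNReal.tsum_eq_iSup_nat]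
    refine iSup_le fun N => ?_
    rw [← lintegral_finsetSum' _ fun n _ => hmeas n]
    refine le_trans (le_of_eq ?_) (ENNReal.ofReal_le_ofReal (hK N))
    rw [ofReal_integral_eq_lintegral_ofReal (integrable_finsetSum _ fun n _ => hi n)
      (Eventually.of_forall fun ω => Finset.sum_nonneg fun n _ => hF n ω)]
    exact lintegral_congr fun ω => (ENNReal.ofReal_sum_of_nonneg fun n _ => hF n ω).symm
  filter_upwards [ae_lt_top' (AEMeasurable.tsum hmeas) hfin] with ω hω
  exact (ENNReal.summable_toReal hω.ne).congr fun n => ENNReal.toReal_ofReal (hF n ω)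

variable [IsProbabilityMeasure μ]

theorem integrable_inv_visits (hY : ∀ n, Measurable (Y n)) (n : ℕ) :
    Integrable (fun ω => 1 / visits Y n ω (Y (n + 1) ω)) μ := by
  refine Integrable.of_bound (C := 1) ?_ (Eventually.of_forall fun ω => ?_)
  · exact (measurable_const.div (measurable_apply_index
      (fun i => measurable_visits (fun k _ => hY k) i) (hY (n + 1)))).aestronglyMeasurable
  · have := one_le_visits Y n ω (Y (n + 1) ω)
    rw [Real.norm_of_nonneg (by positivity)]
    exact (div_le_one (by linarith)).2 this

theorem integrable_inv_otherVisits (hd : 2 ≤ d) (hY : ∀ n, Measurable (Y n)) {n : ℕ}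
    (hn : d ≤ n) : Integrable (fun ω => ((d : ℝ) - 1) / otherVisits Y n ω) μ := by
  have hd' : (2 : ℝ) ≤ d := by exact_mod_cast hd
  refine Integrable.of_bound (C := 1) ?_ (Eventually.of_forall fun ω => ?_)
  · exact (measurable_const.div (measurable_otherVisits hY n)).aestronglyMeasurable
  · have := sub_one_le_otherVisits Y hn ω
    rw [Real.norm_of_nonneg (div_nonneg (by linarith) (by linarith))]
    exact (div_le_one (by linarith)).2 this

theorem integral_inv_visits {R : Matrix (Fin d) (Fin d) ℝ}
    (hR : ∀ i j, R i j = if i = j then 0 else 1) (hY : IsVRRW μ R Y) {n : ℕ} (hn : d ≤ n) :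
    ∫ ω, 1 / visits Y n ω (Y (n + 1) ω) ∂μ = ∫ ω, ((d : ℝ) - 1) / otherVisits Y n ω ∂μ := by
  obtain ⟨hm, -, hcond⟩ := hY
  have hle := natFilt_le hm n
  set f : Fin d → Ω → ℝ := fun j ω => 1 / visits Y n ω j
  set e : Fin d → Ω → ℝ := fun j ω => if Y (n + 1) ω = j then (1 : ℝ) else 0
  have hfm : ∀ j, StronglyMeasurable[natFilt Y n] (f j) := fun j =>
    (measurable_const.div (measurable_visits (fun k hk => measurable_natFilt hk) j)).stronglyMeasurable
  have hem : ∀ j, Measurable (e j) := fun j =>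
    (measurable_of_finite fun i : Fin d => if i = j then (1 : ℝ) else 0).comp (hm (n + 1))
  have hf1 : ∀ j ω, 0 ≤ f j ω ∧ f j ω ≤ 1 := fun j ω => by
    have := one_le_visits Y n ω j
    exact ⟨by positivity, (div_le_one (by linarith)).2 this⟩
  have he1 : ∀ j ω, ‖e j ω‖ ≤ 1 := fun j ω => by
    simp only [e]
    split_ifs <;> simp
  have hei : ∀ j, Integrable (e j) μ := fun j =>
    Integrable.of_bound (hem j).aestronglyMeasurable 1 (Eventually.of_forall (he1 j))
  have hfe : ∀ j, Integrable (f j * e j) μ := fun j =>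
    (hei j).bdd_mul (c := 1) ((hfm j).mono hle).aestronglyMeasurable
      (Eventually.of_forall fun ω => by
        rw [Real.norm_of_nonneg (hf1 j ω).1]
        exact (hf1 j ω).2)
  have hce : ∀ j, μ[f j * e j | natFilt Y n] =ᵐ[μ]
      fun ω => R (Y n ω) j / otherVisits Y n ω := fun j => by
    filter_upwards [condExp_mul_of_stronglyMeasurable_left (hfm j) (hfe j) (hei j),
      hcond n hn j] with ω h1 h2
    rw [h1, Pi.mul_apply, h2]
    have h3 : ∑ i, R (Y n ω) i * visits Y n ω i = otherVisits Y n ω := by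
      have h4 : ∀ i, R (Y n ω) i * visits Y n ω i =
          visits Y n ω i - if Y n ω = i then visits Y n ω i else 0 := fun i => by
        rw [hR]
        split_ifs <;> simp
      simp [h4, Finset.sum_sub_distrib, sum_visits Y hn, otherVisits]
    have h5 : visits Y n ω j ≠ 0 := by linarith [one_le_visits Y n ω j]
    rw [h3]
    simp only [f]
    field_simp
  have hint : ∀ j, Integrable (fun ω => R (Y n ω) j / otherVisits Y n ω) μ := fun j =>
    integrable_condExp.congr (hce j)
  calc ∫ ω, 1 / visits Y n ω (Y (n + 1) ω) ∂μ = ∫ ω, ∑ j, (f j * e j) ω ∂μ := by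
        simp [f, e]
    _ = ∑ j, ∫ ω, (f j * e j) ω ∂μ := integral_finsetSum _ fun j _ => hfe j
    _ = ∑ j, ∫ ω, R (Y n ω) j / otherVisits Y n ω ∂μ :=
        Finset.sum_congr rfl fun j _ => by
          rw [← integral_condExp hle, integral_congr_ae (hce j)]
    _ = ∫ ω, ∑ j, R (Y n ω) j / otherVisits Y n ω ∂μ := (integral_finsetSum _ fun j _ => hint j).symm
    _ = _ := by
        refine integral_congr_ae (Eventually.of_forall fun ω => ?_)
        simp only [← Finset.sum_div]
        congr 1
        have h6 : ∀ j, R (Y n ω) j = 1 - if Y n ω = j then 1 else 0 := fun j => by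
          rw [hR]
          split_ifs <;> simp
        simp [h6, Finset.sum_sub_distrib]

theorem ae_summable_sqNorm (hd : 2 ≤ d) {R : Matrix (Fin d) (Fin d) ℝ}
    (hR : ∀ i j, R i j = if i = j then 0 else 1) (hY : IsVRRW μ R Y) :
    ∀ᵐ ω ∂μ, Summable fun k : ℕ => (sqNorm Y (d + k) ω - 1 / d) / (((d + k : ℕ) : ℝ) + 1) := by
  have hm := hY.1
  have h0 : ∀ (k : ℕ) ω, 0 ≤ (sqNorm Y (d + k) ω - 1 / d) / (((d + k : ℕ) : ℝ) + 1) :=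
    fun k ω => div_nonneg (sqNorm_sub_inv_nonneg Y hd (Nat.le_add_right d k) ω) (by positivity)
  have hi : ∀ k : ℕ,
      Integrable (fun ω => (sqNorm Y (d + k) ω - 1 / d) / (((d + k : ℕ) : ℝ) + 1)) μ := fun k => by
    refine Integrable.of_bound (C := 1)
      (((measurable_sqNorm hm _).sub_const _).div_const _).aestronglyMeasurable
      (Eventually.of_forall fun ω => ?_)
    rw [Real.norm_of_nonneg (h0 k ω), div_le_one (by positivity)]
    have h1 := sqNorm_le_one Y hd (Nat.le_add_right d k) ω
    have h2 : (0 : ℝ) ≤ 1 / d := by positivity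
    have h3 : (0 : ℝ) ≤ (d + k : ℕ) := by positivity
    linarith
  refine ae_summable_of_integral_sum_le (K := 2 * (d : ℝ) ^ 2) h0 hi fun N => ?_
  have hD : ∀ k : ℕ, Integrable (fun ω => 1 / visits Y (d + k) ω (Y (d + k + 1) ω) -
      (d - 1) / otherVisits Y (d + k) ω) μ := fun k =>
    (integrable_inv_visits hm _).sub (integrable_inv_otherVisits hd hm (Nat.le_add_right d k))
  have hz : ∫ ω, ∑ k ∈ Finset.range (N + 1), (1 / visits Y (d + k) ω (Y (d + k + 1) ω) -
      (d - 1) / otherVisits Y (d + k) ω) ∂μ = 0 := by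
    rw [integral_finsetSum _ fun k _ => hD k]
    refine Finset.sum_eq_zero fun k _ => ?_
    rw [integral_sub (integrable_inv_visits hm _)
      (integrable_inv_otherVisits hd hm (Nat.le_add_right d k)),
      integral_inv_visits hR hY (Nat.le_add_right d k), sub_self]
  have hS := integrable_finsetSum (Finset.range N) fun k _ => hi k
  have h := integral_mono (integrable_finsetSum (Finset.range (N + 1)) fun k _ => hD k)
    ((integrable_const (2 * (d : ℝ) ^ 2)).sub hS) (fun ω => sum_compensated_le Y hd N ω)
  rw [hz, integral_sub' (integrable_const _) hS] at h
  simp at h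
  simpa using h

end Expectation

end VRRW

/-- If `R` is the adjacency matrix of the complete graph on `d` vertices,
then almost surely `V(n) → (1/d, …, 1/d)`. -/
theorem stmt10 {d : ℕ} (hd : 2 ≤ d) (R : Matrix (Fin d) (Fin d) ℝ)
    (hR : ∀ i j, R i j = if i = j then 0 else 1)
    {Ω : Type} [MeasurableSpace Ω] (μ : Measure Ω) [IsProbabilityMeasure μ]
    (Y : ℕ → Ω → Fin d) (hY : IsVRRW μ R Y) :
    ∀ᵐ ω ∂μ, Tendsto (fun n => occup Y n ω) atTop (nhds (fun _ => 1 / (d : ℝ))) := by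
  filter_upwards [ae_summable_sqNorm hd hR hY] with ω hω
  have hg : Tendsto (fun k => sqNorm Y (d + k) ω - 1 / d) atTop (nhds 0) := by
    refine tendsto_zero_of_summable_div (a := (d : ℝ) + 1) (C := 4) (by positivity)
      (fun k => sqNorm_sub_inv_nonneg Y hd (Nat.le_add_right d k) ω) (hω.congr fun k => ?_) fun k => ?_
    · push_cast
      ring
    · have h := abs_sqNorm_succ_sub_le Y hd (Nat.le_add_right d k) ω
      rw [sub_sub_sub_cancel_right, ← add_assoc]
      convert h using 2
      push_cast
      ring
  rw [tendsto_pi_nhds]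
  intro i
  rw [← tendsto_add_atTop_iff_nat d, ← tendsto_sub_nhds_zero_iff]
  have hsqrt : Tendsto (fun k => √(sqNorm Y (d + k) ω - 1 / d)) atTop (nhds 0) := by
    simpa using hg.sqrt
  refine squeeze_zero_norm (fun k => ?_) hsqrt
  refine Real.le_sqrt_of_sq_le ?_
  rw [Real.norm_eq_abs, sq_abs, ← sum_sq_sub Y hd (Nat.le_add_right d k), add_comm k d]
  exact Finset.single_le_sum (f := fun i => (occup Y (d + k) ω i - 1 / (d : ℝ)) ^ 2)
    (fun _ _ => sq_nonneg _) (Finset.mem_univ i)
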